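/- arXiv:2402.02792 — 3 statements merged into one kernel-verified Lean document; each statement's English description precedes it below -/
import Mathlib

section
/- The following four quantities are equal: (1) E[ inf_{α ∈ A^B} sup_{b ∈ B} Q(X, α(b), b) ], where A^B is the set of all functions from B to A; (2) inf_{α ∈ G} sup_{b ∈ ℬ} E[ Q(X, α(X, b(X)), b(X)) ], where G = Meas(ℝ^d × B, A); (3) E[ sup_{b ∈ B} inf_{a ∈ A} Q(X, a, b) ]; (4) sup_{b ∈ ℬ} inf_{a ∈ 𝒜} E[ Q(X, a(X), b(X)) ]. -/
open MeasureTheory Set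

noncomputable section

abbrev Euc (n : ℕ) : Type := EuclideanSpace ℝ (Fin n)

/-- periodic extension of a `Fin N`-tuple to an `ℕ`-indexed family -/
def extp {γ : Sort*} {N : ℕ} (hN : 0 < N) (c : Fin N → γ) : ℕ → γ :=
  fun k => c ⟨k % N, Nat.mod_lt k hN⟩

/-- discrete trajectory driven by open-loop controls -/
def oTraj {d nA nB : ℕ} (F : Euc d → Euc nA → Euc nB → Euc d) (x : Euc d)
    (a : ℕ → Euc nA) (b : ℕ → Euc nB) : ℕ → Euc d
  | 0 => x
  | k + 1 => F (oTraj F x a b k) (a k) (b k)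

/-- payoff `(max_{0 ≤ k ≤ N-1} g(x_k)) ⊔ φ(x_N)` -/
def payoff {d : ℕ} (g φ : Euc d → ℝ) (N : ℕ) (xs : ℕ → Euc d) : ℝ :=
  (⨆ k : Fin N, g (xs k)) ⊔ φ (xs N)

def J0 {d nA nB : ℕ} (F : Euc d → Euc nA → Euc nB → Euc d) (g φ : Euc d → ℝ)
    {N : ℕ} (hN : 0 < N) (x : Euc d) (a : Fin N → Euc nA) (b : Fin N → Euc nB) : ℝ :=
  payoff g φ N (oTraj F x (extp hN a) (extp hN b))

/-- discrete non-anticipative strategies -/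
def SN {nA nB : ℕ} (A : Set (Euc nA)) (B : Set (Euc nB)) (N : ℕ) : Type :=
  {α : (Fin N → B) → Fin N → A //
    Measurable α ∧ ∀ (k : Fin N) (b b' : Fin N → B), (∀ j ≤ k, b j = b' j) → α b k = α b' k}

/-- Elliott–Kalton semi-discrete value -/
def V0 {d nA nB : ℕ} (A : Set (Euc nA)) (B : Set (Euc nB))
    (F : Euc d → Euc nA → Euc nB → Euc d) (g φ : Euc d → ℝ) {N : ℕ} (hN : 0 < N)
    (x : Euc d) : ℝ :=
  ⨅ α : SN A B N, ⨆ b : Fin N → B,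
    J0 F g φ hN x (fun i => (α.1 b i : Euc nA)) (fun i => (b i : Euc nB))

/-- nested alternating sup-inf value -/
def altVal {α β : Type*} : (n : ℕ) → ((Fin n → α) → (Fin n → β) → ℝ) → ℝ
  | 0, J => J (fun i => i.elim0) (fun i => i.elim0)
  | n + 1, J => ⨆ b0 : β, ⨅ a0 : α, altVal n (fun a b => J (Fin.cons a0 a) (Fin.cons b0 b))

/-- Fleming alternating value -/
def flemingV0 {d nA nB : ℕ} (A : Set (Euc nA)) (B : Set (Euc nB))
    (F : Euc d → Euc nA → Euc nB → Euc d) (g φ : Euc d → ℝ) {N : ℕ} (hN : 0 < N)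
    (x : Euc d) : ℝ :=
  altVal N (fun (a : Fin N → A) (b : Fin N → B) =>
    J0 F g φ hN x (fun i => (a i : Euc nA)) (fun i => (b i : Euc nB)))

/-- feedback trajectory -/
def fbTraj {d nA nB : ℕ} {A : Set (Euc nA)} {B : Set (Euc nB)}
    (F : Euc d → Euc nA → Euc nB → Euc d) (x : Euc d)
    (α : ℕ → Euc d × B → A) (b : ℕ → Euc d → B) : ℕ → Euc d
  | 0 => x
  | k + 1 =>
    F (fbTraj F x α b k)
      (α k (fbTraj F x α b k, b k (fbTraj F x α b k)) : Euc nA)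
      (b k (fbTraj F x α b k) : Euc nB)

/-- set of measurable feedback strategies `ℝ^d × B → A` -/
def Gm (d : ℕ) {nA nB : ℕ} (A : Set (Euc nA)) (B : Set (Euc nB)) : Type :=
  {α : Euc d × B → A // Measurable α}

/-- set of measurable feedback controls `ℝ^d → B` -/
def Bm (d : ℕ) {nB : ℕ} (B : Set (Euc nB)) : Type :=
  {b : Euc d → B // Measurable b}

def Am (d : ℕ) {nA : ℕ} (A : Set (Euc nA)) : Type :=
  {a : Euc d → A // Measurable a}

/-- payoff `J̃0` for a feedback strategy against an open-loop control -/
def tJ0 {d nA nB : ℕ} {A : Set (Euc nA)} {B : Set (Euc nB)}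
    (F : Euc d → Euc nA → Euc nB → Euc d) (g φ : Euc d → ℝ) {N : ℕ} (hN : 0 < N)
    (x : Euc d) (α : Fin N → Euc d × B → A) (b : Fin N → B) : ℝ :=
  payoff g φ N (fbTraj F x (extp hN α) (fun k _ => extp hN b k))

/-- payoff `J̃0` for a feedback strategy against a feedback control -/
def tJ0fb {d nA nB : ℕ} {A : Set (Euc nA)} {B : Set (Euc nB)}
    (F : Euc d → Euc nA → Euc nB → Euc d) (g φ : Euc d → ℝ) {N : ℕ} (hN : 0 < N)
    (x : Euc d) (α : Fin N → Euc d × B → A) (b : Fin N → Euc d → B) : ℝ :=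
  payoff g φ N (fbTraj F x (extp hN α) (extp hN b))

/-- feedback value `Ṽ0` -/
def tV0 {d nA nB : ℕ} (A : Set (Euc nA)) (B : Set (Euc nB))
    (F : Euc d → Euc nA → Euc nB → Euc d) (g φ : Euc d → ℝ) {N : ℕ} (hN : 0 < N)
    (x : Euc d) : ℝ :=
  ⨅ α : Fin N → Gm d A B, ⨆ b : Fin N → B,
    tJ0 F g φ hN x (fun k => (α k).1) b

/-- intermediate value functions (backward DPP); `Vk m` is the value with `m` steps to go. -/
def Vdpp {d nA nB : ℕ} (A : Set (Euc nA)) (B : Set (Euc nB))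
    (F : Euc d → Euc nA → Euc nB → Euc d) (g φ : Euc d → ℝ) : ℕ → Euc d → ℝ
  | 0, x => φ x
  | m + 1, x => ⨆ b : B, ⨅ a : A, g x ⊔ Vdpp A B F g φ m (F x (a : Euc nA) (b : Euc nB))


section Selection

open TopologicalSpace

variable {Y K : Type*} [TopologicalSpace K]

theorem DenseRange.ciSup_comp_eq {ι α : Type*} [ConditionallyCompleteLattice α]
    [TopologicalSpace α] [ClosedIicTopology α] [Nonempty ι] {u : ι → K} (hu : DenseRange u)
    {f : K → α} (hf : Continuous f) (hb : BddAbove (range f)) : ⨆ i, f (u i) = ⨆ k, f k := by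
  have : Nonempty K := ‹Nonempty ι›.map u
  have hbu : BddAbove (range fun i => f (u i)) := hb.mono (range_comp_subset_range u f)
  refine le_antisymm (ciSup_le fun i => le_ciSup hb (u i)) (ciSup_le fun k => ?_)
  exact hu.induction_on k (isClosed_Iic.preimage hf) fun i => le_ciSup hbu i

theorem DenseRange.ciInf_comp_eq {ι α : Type*} [ConditionallyCompleteLattice α]
    [TopologicalSpace α] [ClosedIciTopology α] [Nonempty ι] {u : ι → K} (hu : DenseRange u)
    {f : K → α} (hf : Continuous f) (hb : BddBelow (range f)) : ⨅ i, f (u i) = ⨅ k, f k :=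
  DenseRange.ciSup_comp_eq (α := αᵒᵈ) hu hf hb

variable [MeasurableSpace Y] [Nonempty K] [CompactSpace K] [SeparableSpace K] {f : Y → K → ℝ}

theorem measurable_ciSup_of_continuous (hm : ∀ k, Measurable fun y => f y k)
    (hc : ∀ y, Continuous (f y)) : Measurable fun y => ⨆ k, f y k := by
  have h : (fun y => ⨆ k, f y k) = fun y => ⨆ n, f y (denseSeq K n) := funext fun y =>
    ((denseRange_denseSeq K).ciSup_comp_eq (hc y)
      (isCompact_range (hc y)).bddAbove).symm
  rw [h]
  exact Measurable.iSup fun n => hm _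

theorem measurable_ciInf_of_continuous (hm : ∀ k, Measurable fun y => f y k)
    (hc : ∀ y, Continuous (f y)) : Measurable fun y => ⨅ k, f y k := by
  have h : (fun y => ⨅ k, f y k) = fun y => ⨅ n, f y (denseSeq K n) := funext fun y =>
    ((denseRange_denseSeq K).ciInf_comp_eq (hc y)
      (isCompact_range (hc y)).bddBelow).symm
  rw [h]
  exact Measurable.iInf fun n => hm _

/-- A Carathéodory function on a separable compact space has measurable `ε`-minimizers. -/
theorem exists_measurable_le_add [MeasurableSpace K] (hm : ∀ k, Measurable fun y => f y k)
    (hc : ∀ y, Continuous (f y)) {ε : ℝ} (hε : 0 < ε) :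
    ∃ s : Y → K, Measurable s ∧ ∀ y k, f y (s y) ≤ f y k + ε := by
  classical
  have hb : ∀ y, BddBelow (range (f y)) := fun y => (isCompact_range (hc y)).bddBelow
  have hex : ∀ y, ∃ n, f y (denseSeq K n) < (⨅ k, f y k) + ε := fun y => by
    rw [← (denseRange_denseSeq K).ciInf_comp_eq (hc y) (hb y)]
    exact exists_lt_of_ciInf_lt (lt_add_of_pos_right _ hε)
  refine ⟨fun y => denseSeq K (Nat.find (hex y)), ?_, fun y k => ?_⟩
  · exact (measurable_from_nat (f := denseSeq K)).comp (measurable_find hex fun n =>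
      measurableSet_lt (hm _) ((measurable_ciInf_of_continuous hm hc).add_const ε))
  · exact (Nat.find_spec (hex y)).le.trans (by gcongr; exact ciInf_le (hb y) k)

/-- A Carathéodory function on a separable compact space has measurable `ε`-maximizers. -/
theorem exists_measurable_sub_le [MeasurableSpace K] (hm : ∀ k, Measurable fun y => f y k)
    (hc : ∀ y, Continuous (f y)) {ε : ℝ} (hε : 0 < ε) :
    ∃ s : Y → K, Measurable s ∧ ∀ y k, f y k ≤ f y (s y) + ε := by
  obtain ⟨s, hs, h⟩ := exists_measurable_le_add (f := fun y k => -f y k)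
    (fun k => (hm k).neg) (fun y => (hc y).neg) hε
  exact ⟨s, hs, fun y k => by linarith [h y k]⟩

end Selection

theorem continuous_ciInf_of_compact {A B : Type*} [TopologicalSpace A] [TopologicalSpace B]
    [CompactSpace A] {q : A → B → ℝ} (hq : Continuous fun p : A × B => q p.1 p.2) :
    Continuous fun b => ⨅ a, q a b := by
  have h := isCompact_univ.continuous_sInf (f := fun b a => q a b) (K := (univ : Set A))
    (hq.comp continuous_swap)
  simpa only [image_univ, sInf_range] using h

theorem bddBelow_range_of_abs_le {ι : Type*} {f : ι → ℝ} {c : ℝ} (h : ∀ i, |f i| ≤ c) :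
    BddBelow (range f) :=
  ⟨-c, forall_mem_range.2 fun i => neg_le_of_abs_le (h i)⟩

theorem bddAbove_range_of_abs_le {ι : Type*} {f : ι → ℝ} {c : ℝ} (h : ∀ i, |f i| ≤ c) :
    BddAbove (range f) :=
  ⟨c, forall_mem_range.2 fun i => le_of_abs_le (h i)⟩

theorem abs_ciInf_le {ι : Type*} [Nonempty ι] {f : ι → ℝ} {c : ℝ} (h : ∀ i, |f i| ≤ c) :
    |⨅ i, f i| ≤ c :=
  abs_le.2 ⟨le_ciInf fun i => neg_le_of_abs_le (h i),
    (ciInf_le (bddBelow_range_of_abs_le h) (Classical.arbitrary ι)).trans (le_of_abs_le (h _))⟩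

theorem abs_ciSup_le {ι : Type*} [Nonempty ι] {f : ι → ℝ} {c : ℝ} (h : ∀ i, |f i| ≤ c) :
    |⨆ i, f i| ≤ c :=
  abs_le.2 ⟨(neg_le_of_abs_le (h (Classical.arbitrary ι))).trans
      (le_ciSup (bddAbove_range_of_abs_le h) _),
    ciSup_le fun i => le_of_abs_le (h i)⟩

theorem ciInf_pi_ciSup_eq {A B : Type*} [Nonempty A] [Nonempty B] {q : A → B → ℝ} {c : ℝ}
    (hq : ∀ a b, |q a b| ≤ c) :
    ⨅ α : B → A, ⨆ b, q (α b) b = ⨆ b, ⨅ a, q a b := by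
  have hb : ∀ b, BddBelow (range fun a => q a b) := fun b =>
    bddBelow_range_of_abs_le fun a => hq a b
  have ha : ∀ α : B → A, BddAbove (range fun b => q (α b) b) := fun α =>
    bddAbove_range_of_abs_le fun b => hq (α b) b
  have hi : BddAbove (range fun b => ⨅ a, q a b) :=
    bddAbove_range_of_abs_le fun b => abs_ciInf_le fun a => hq a b
  have hs : BddBelow (range fun α : B → A => ⨆ b, q (α b) b) :=
    bddBelow_range_of_abs_le fun α => abs_ciSup_le fun b => hq (α b) b
  refine le_antisymm (le_of_forall_pos_le_add fun ε hε => ?_)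
    (le_ciInf fun α => ciSup_mono (ha α) fun b => ciInf_le (hb b) (α b))
  choose α hα using fun b => exists_lt_of_ciInf_lt (lt_add_of_pos_right (⨅ a, q a b) hε)
  refine (ciInf_le hs α).trans (ciSup_le fun b => (hα b).le.trans ?_)
  gcongr
  exact le_ciSup hi b

theorem abs_integral_le_of_abs_le {W : Type*} [MeasurableSpace W] {μ : Measure W}
    {h g : W → ℝ} (hg : Integrable g μ) (hh : ∀ ω, |h ω| ≤ g ω) :
    |∫ ω, h ω ∂μ| ≤ ∫ ω, g ω ∂μ :=
  norm_integral_le_of_norm_le (f := h) hg (Filter.Eventually.of_forall hh)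

theorem integral_le_integral_add {W : Type*} [MeasurableSpace W] {μ : Measure W}
    [IsProbabilityMeasure μ] {h g : W → ℝ} (hh : Integrable h μ) (hg : Integrable g μ) {ε : ℝ}
    (hle : ∀ ω, h ω ≤ g ω + ε) : ∫ ω, h ω ∂μ ≤ ∫ ω, g ω ∂μ + ε := by
  calc ∫ ω, h ω ∂μ ≤ ∫ ω, (g ω + ε) ∂μ := integral_mono hh (hg.add (integrable_const ε)) hle
    _ = ∫ ω, g ω ∂μ + ε := by rw [integral_add hg (integrable_const ε)]; simp

section Commutation

open TopologicalSpace

variable {E A B W : Type*} [MeasurableSpace E]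
  [TopologicalSpace A] [CompactSpace A] [SeparableSpace A] [Nonempty A] [MeasurableSpace A]
  [TopologicalSpace B] [CompactSpace B] [SeparableSpace B] [Nonempty B] [MeasurableSpace B]
  [MeasurableSpace W] {μ : Measure W} [IsProbabilityMeasure μ] {X : W → E} {Q : E → A → B → ℝ}
  {G : E → ℝ}

/-- Interchange of expectation with `inf sup` over feedback strategies and with `sup inf` over
feedback controls, for a Carathéodory payoff. -/
theorem integral_ciSup_ciInf_eq_of_continuous (hX : Measurable X)
    (hG : Integrable (fun ω => G (X ω)) μ)
    (hQm : Measurable fun p : E × A × B => Q p.1 p.2.1 p.2.2)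
    (hQG : ∀ x a b, |Q x a b| ≤ G x)
    (hc : ∀ x, Continuous fun p : A × B => Q x p.1 p.2) :
    (⨅ α : {α : E × B → A // Measurable α}, ⨆ b : {b : E → B // Measurable b},
        ∫ ω, Q (X ω) (α.1 (X ω, b.1 (X ω))) (b.1 (X ω)) ∂μ) =
      (∫ ω, (⨆ b : B, ⨅ a : A, Q (X ω) a b) ∂μ) ∧
    (∫ ω, (⨆ b : B, ⨅ a : A, Q (X ω) a b) ∂μ) =
      ⨆ b : {b : E → B // Measurable b}, ⨅ a : {a : E → A // Measurable a},
        ∫ ω, Q (X ω) (a.1 (X ω)) (b.1 (X ω)) ∂μ := by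
  have : Nonempty {α : E × B → A // Measurable α} :=
    ⟨⟨fun _ => Classical.arbitrary A, measurable_const⟩⟩
  have : Nonempty {b : E → B // Measurable b} :=
    ⟨⟨fun _ => Classical.arbitrary B, measurable_const⟩⟩
  have : Nonempty {a : E → A // Measurable a} :=
    ⟨⟨fun _ => Classical.arbitrary A, measurable_const⟩⟩
  have hQa : ∀ a, Measurable fun y : E × B => Q y.1 a y.2 := fun a =>
    hQm.comp (measurable_fst.prodMk (measurable_const.prodMk measurable_snd))
  have hca : ∀ y : E × B, Continuous fun a => Q y.1 a y.2 := fun y =>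
    (hc y.1).comp (by fun_prop : Continuous fun a : A => (a, y.2))
  have hmm : Measurable fun y : E × B => ⨅ a, Q y.1 a y.2 :=
    measurable_ciInf_of_continuous hQa hca
  have hmb : ∀ b, Measurable fun x => ⨅ a, Q x a b := fun b =>
    hmm.comp (measurable_id.prodMk measurable_const)
  have hcm : ∀ x, Continuous fun b => ⨅ a, Q x a b := fun x => continuous_ciInf_of_compact (hc x)
  have hmG : ∀ x b, |⨅ a, Q x a b| ≤ G x := fun x b => abs_ciInf_le fun a => hQG x a b
  have hint : ∀ h : E → ℝ, Measurable h → (∀ x, |h x| ≤ G x) →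
      Integrable (fun ω => h (X ω)) μ := fun h hh hhG =>
    hG.mono' (hh.comp hX).aestronglyMeasurable (Filter.Eventually.of_forall fun ω => hhG _)
  have hvi : Integrable (fun ω => ⨆ b, ⨅ a, Q (X ω) a b) μ :=
    hint (fun x => ⨆ b, ⨅ a, Q x a b) (measurable_ciSup_of_continuous hmb hcm)
      fun x => abs_ciSup_le (hmG x)
  have hQi : ∀ a : E → A, Measurable a → ∀ b : E → B, Measurable b →
      Integrable (fun ω => Q (X ω) (a (X ω)) (b (X ω))) μ := fun a ha b hb =>
    hint (fun x => Q x (a x) (b x)) (hQm.comp (measurable_id.prodMk (ha.prodMk hb)))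
      fun x => hQG _ _ _
  have hmv : ∀ x b, ⨅ a, Q x a b ≤ ⨆ b, ⨅ a, Q x a b := fun x b =>
    le_ciSup (bddAbove_range_of_abs_le (hmG x)) b
  have hmQ : ∀ x a b, ⨅ a, Q x a b ≤ Q x a b := fun x a b =>
    ciInf_le (bddBelow_range_of_abs_le fun a => hQG x a b) a
  have hJ : ∀ (a : E → A) (b : E → B),
      |∫ ω, Q (X ω) (a (X ω)) (b (X ω)) ∂μ| ≤ ∫ ω, G (X ω) ∂μ := fun a b =>
    abs_integral_le_of_abs_le hG fun ω => hQG _ _ _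
  have hα : ∀ ε : ℝ, 0 < ε → ∃ α : E × B → A, Measurable α ∧
      ∀ x b, Q x (α (x, b)) b ≤ (⨆ b, ⨅ a, Q x a b) + ε := fun ε hε => by
    obtain ⟨α, hαm, h⟩ := exists_measurable_le_add hQa hca hε
    refine ⟨α, hαm, fun x b => ?_⟩
    have : Q x (α (x, b)) b - ε ≤ ⨅ a, Q x a b := le_ciInf fun a => by linarith [h (x, b) a]
    linarith [hmv x b]
  have hβ : ∀ ε : ℝ, 0 < ε → ∃ b : E → B, Measurable b ∧
      ∀ x a, (⨆ b, ⨅ a, Q x a b) ≤ Q x a (b x) + ε := fun ε hε => by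
    obtain ⟨b, hbm, h⟩ := exists_measurable_sub_le hmb hcm hε
    exact ⟨b, hbm, fun x a => (ciSup_le (h x)).trans (by gcongr; exact hmQ x a (b x))⟩
  refine ⟨le_antisymm (le_of_forall_pos_le_add fun ε hε => ?_)
    (le_ciInf fun α => le_of_forall_pos_le_add fun ε hε => ?_),
    le_antisymm (le_of_forall_pos_le_add fun ε hε => ?_)
    (ciSup_le fun b => le_of_forall_pos_le_add fun ε hε => ?_)⟩
  · obtain ⟨α, hαm, h⟩ := hα ε hε
    refine ciInf_le_of_le (bddBelow_range_of_abs_le fun α => abs_ciSup_le fun b =>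
      hJ (fun x => α.1 (x, b.1 x)) b.1) ⟨α, hαm⟩ (ciSup_le fun b => ?_)
    exact integral_le_integral_add
      (hQi (fun x => α (x, b.1 x)) (hαm.comp (measurable_id.prodMk b.2)) b.1 b.2) hvi
      fun ω => h _ _
  · obtain ⟨b, hbm, h⟩ := hβ ε hε
    refine (integral_le_integral_add hvi
      (hQi (fun x => α.1 (x, b x)) (α.2.comp (measurable_id.prodMk hbm)) b hbm)
      fun ω => h _ _).trans ?_
    gcongr
    exact le_ciSup (f := fun b : {b : E → B // Measurable b} =>
      ∫ ω, Q (X ω) (α.1 (X ω, b.1 (X ω))) (b.1 (X ω)) ∂μ)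
      (bddAbove_range_of_abs_le fun b => hJ (fun x => α.1 (x, b.1 x)) b.1) ⟨b, hbm⟩
  · obtain ⟨b, hbm, h⟩ := hβ ε hε
    rw [← sub_le_iff_le_add]
    refine le_ciSup_of_le (bddAbove_range_of_abs_le fun b => abs_ciInf_le fun a => hJ a.1 b.1)
      ⟨b, hbm⟩ (le_ciInf fun a => ?_)
    rw [sub_le_iff_le_add]
    exact integral_le_integral_add hvi (hQi a.1 a.2 b hbm) fun ω => h _ _
  · obtain ⟨α, hαm, h⟩ := hα ε hε
    have hαb : Measurable fun x => α (x, b.1 x) := hαm.comp (measurable_id.prodMk b.2)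
    exact ciInf_le_of_le (bddBelow_range_of_abs_le fun a => hJ a.1 b.1) ⟨_, hαb⟩
      (integral_le_integral_add (hQi _ hαb b.1 b.2) hvi fun ω => h _ _)

/-- The interchange under almost sure continuity of the payoff. -/
theorem integral_ciSup_ciInf_eq (hX : Measurable X)
    (hG : Integrable (fun ω => G (X ω)) μ)
    (hQm : Measurable fun p : E × A × B => Q p.1 p.2.1 p.2.2)
    (hQG : ∀ x a b, |Q x a b| ≤ G x)
    (hc : ∀ᵐ x ∂μ.map X, Continuous fun p : A × B => Q x p.1 p.2) :
    (⨅ α : {α : E × B → A // Measurable α}, ⨆ b : {b : E → B // Measurable b},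
        ∫ ω, Q (X ω) (α.1 (X ω, b.1 (X ω))) (b.1 (X ω)) ∂μ) =
      (∫ ω, (⨆ b : B, ⨅ a : A, Q (X ω) a b) ∂μ) ∧
    (∫ ω, (⨆ b : B, ⨅ a : A, Q (X ω) a b) ∂μ) =
      ⨆ b : {b : E → B // Measurable b}, ⨅ a : {a : E → A // Measurable a},
        ∫ ω, Q (X ω) (a.1 (X ω)) (b.1 (X ω)) ∂μ := by
  classical
  set N := toMeasurable (μ.map X) {x | ¬Continuous fun p : A × B => Q x p.1 p.2} with hN
  have hNm : MeasurableSet N := measurableSet_toMeasurable _ _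
  have hN0 : ∀ᵐ ω ∂μ, X ω ∉ N := by
    refine ae_of_ae_map hX.aemeasurable (p := fun x => x ∉ N) (measure_eq_zero_iff_ae_notMem.1 ?_)
    rw [hN, measure_toMeasurable]
    exact hc
  have hG0 : ∀ x, 0 ≤ G x := fun x =>
    (abs_nonneg _).trans (hQG x (Classical.arbitrary A) (Classical.arbitrary B))
  let R : E → A → B → ℝ := fun x a b => if x ∈ N then 0 else Q x a b
  have hR : ∀ᵐ ω ∂μ, ∀ a b, R (X ω) a b = Q (X ω) a b :=
    hN0.mono fun ω h a b => if_neg h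
  have key := integral_ciSup_ciInf_eq_of_continuous (μ := μ) (Q := R) hX hG
    (Measurable.ite (measurable_fst hNm) measurable_const hQm)
    (fun x a b => by
      by_cases h : x ∈ N
      · simpa [R, h] using hG0 x
      · simpa [R, h] using hQG x a b)
    (fun x => by
      by_cases h : x ∈ N
      · simpa [R, h] using continuous_const
      · have : Continuous fun p : A × B => Q x p.1 p.2 :=
          not_not.1 fun hx => h (subset_toMeasurable _ _ hx)
        simpa [R, h] using this)
  have hRQ : ∀ (a : W → A) (b : W → B),
      ∫ ω, R (X ω) (a ω) (b ω) ∂μ = ∫ ω, Q (X ω) (a ω) (b ω) ∂μ := fun a b =>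
    integral_congr_ae (hR.mono fun ω h => h _ _)
  have hRv : ∫ ω, (⨆ b : B, ⨅ a : A, R (X ω) a b) ∂μ = ∫ ω, (⨆ b : B, ⨅ a : A, Q (X ω) a b) ∂μ :=
    integral_congr_ae (hR.mono fun ω h => by simp only [h])
  simpa only [hRQ, hRv] using key

end Commutation

theorem minmax_commutation_expectation {d nA nB : ℕ} (hnA : 1 ≤ nA) (hnB : 1 ≤ nB)
    (A : Set (Euc nA)) (hAne : A.Nonempty) (hAc : IsCompact A)
    (B : Set (Euc nB)) (hBne : B.Nonempty) (hBc : IsCompact B)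
    {W : Type*} [MeasurableSpace W] (μ : Measure W) [IsProbabilityMeasure μ]
    (X : W → Euc d) (hX : Measurable X)
    (hXint : Integrable (fun ω => ‖X ω‖) μ)
    (Q : Euc d → A → B → ℝ)
    (hQm : Measurable fun p : Euc d × A × B => Q p.1 p.2.1 p.2.2)
    (C : ℝ) (hC : 0 ≤ C) (hgrow : ∀ (x : Euc d) (a : A) (b : B), |Q x a b| ≤ C * (1 + ‖x‖))
    (hcont : ∀ᵐ x ∂(μ.map X), Continuous fun p : A × B => Q x p.1 p.2) :
    (∫ ω, (⨅ α : B → A, ⨆ b : B, Q (X ω) (α b) b) ∂μ) =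
        (⨅ α : Gm d A B, ⨆ b : Bm d B,
          ∫ ω, Q (X ω) (α.1 (X ω, b.1 (X ω))) (b.1 (X ω)) ∂μ) ∧
      (⨅ α : Gm d A B, ⨆ b : Bm d B,
          ∫ ω, Q (X ω) (α.1 (X ω, b.1 (X ω))) (b.1 (X ω)) ∂μ) =
        (∫ ω, (⨆ b : B, ⨅ a : A, Q (X ω) a b) ∂μ) ∧
      (∫ ω, (⨆ b : B, ⨅ a : A, Q (X ω) a b) ∂μ) =
        (⨆ b : Bm d B, ⨅ a : Am d A, ∫ ω, Q (X ω) (a.1 (X ω)) (b.1 (X ω)) ∂μ) := by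
  have : Nonempty A := hAne.to_subtype
  have : Nonempty B := hBne.to_subtype
  have : CompactSpace A := isCompact_iff_compactSpace.1 hAc
  have : CompactSpace B := isCompact_iff_compactSpace.1 hBc
  obtain ⟨h₁, h₂⟩ := integral_ciSup_ciInf_eq (μ := μ) (G := fun x => C * (1 + ‖x‖)) hX
    (((integrable_const 1).add hXint).const_mul C) hQm hgrow hcont
  have h₀ : ∀ ω, ⨅ α : B → A, ⨆ b : B, Q (X ω) (α b) b = ⨆ b : B, ⨅ a : A, Q (X ω) a b :=
    fun ω => ciInf_pi_ciSup_eq (hgrow (X ω))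
  simp only [h₀]
  exact ⟨h₁.symm, h₁, h₂⟩

end
end

section
/- Let α and ᾱ be two elements of (G_L)^N, let b ∈ B^N, and let x, y ∈ ℝ^d. Assume that X_{k,x}^{α[b],b} ∈ Ω_N for all 0 ≤ k ≤ N, where Ω_N is a given subset of ℝ^d. Then max_{0≤k≤N} | X_{k,y}^{ᾱ[b],b} − X_{k,x}^{α[b],b} | ≤ e^{C_{1,L} T} ( |y − x| + C_2 T max_{0≤k≤N−1} ‖ᾱ_k − α_k‖_{L^∞(Ω_N × B)} ), where C_{1,L} = [f]_1 + [f]_2 L and C_2 = [f]_2. -/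
open MeasureTheory Set

noncomputable section

/-- discrete Gronwall inequality with constant forcing -/
theorem le_pow_mul_add_of_le_mul_add {e : ℕ → ℝ} {q δ : ℝ} {N : ℕ} (hq : 1 ≤ q) (hδ : 0 ≤ δ)
    (he : ∀ k < N, e (k + 1) ≤ q * e k + δ) :
    ∀ k ≤ N, e k ≤ q ^ k * (e 0 + k * δ) := by
  intro k
  induction k with
  | zero => intro _; simp
  | succ k ih =>
    intro hk
    have h1 := he k (by omega)
    have h2 := mul_le_mul_of_nonneg_left (ih (by omega)) (zero_le_one.trans hq)
    have h3 : δ ≤ q ^ (k + 1) * δ := le_mul_of_one_le_left hδ (one_le_pow₀ hq)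
    push_cast
    rw [pow_succ] at *
    linarith

/-- pointwise distance of two families with values in a bounded set is at most the iterated
supremum of the distances -/
theorem norm_sub_le_iSup₃ {E ι κ μ : Type*} [SeminormedAddCommGroup E] {A : Set E}
    (hA : Bornology.IsBounded A) (u v : ι → κ → μ → A) (i : ι) (j : κ) (k : μ) :
    ‖(u i j k : E) - (v i j k : E)‖ ≤ ⨆ (i : ι) (j : κ) (k : μ), ‖(u i j k : E) - (v i j k : E)‖ := by
  have hD : ∀ i j k, ‖(u i j k : E) - (v i j k : E)‖ ≤ Metric.diam A := fun i j k => by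
    rw [← dist_eq_norm]
    exact Metric.dist_le_diam_of_mem hA (u i j k).2 (v i j k).2
  have h1 : ∀ i j, ⨆ k, ‖(u i j k : E) - (v i j k : E)‖ ≤ Metric.diam A :=
    fun i j => Real.iSup_le (hD i j) Metric.diam_nonneg
  have h2 : ∀ i, ⨆ (j) (k), ‖(u i j k : E) - (v i j k : E)‖ ≤ Metric.diam A :=
    fun i => Real.iSup_le (h1 i) Metric.diam_nonneg
  refine le_trans ?_ (le_ciSup ⟨_, forall_mem_range.2 h2⟩ i)
  refine le_trans ?_ (le_ciSup ⟨_, forall_mem_range.2 (h1 i)⟩ j)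
  exact le_ciSup (f := fun k => ‖(u i j k : E) - (v i j k : E)‖) ⟨_, forall_mem_range.2 (hD i j)⟩ k

theorem gronwall_strategy_perturbation {d nA nB : ℕ} (hnA : 1 ≤ nA) (hnB : 1 ≤ nB)
    (A : Set (Euc nA)) (hAne : A.Nonempty) (hAc : IsCompact A)
    (B : Set (Euc nB)) (hBne : B.Nonempty) (hBc : IsCompact B)
    (f : Euc d → Euc nA → Euc nB → Euc d)
    (L1 L2 L3 : ℝ) (hL1 : 0 ≤ L1) (hL2 : 0 ≤ L2) (hL3 : 0 ≤ L3)
    (hf : ∀ x x' : Euc d, ∀ a a' : Euc nA, a ∈ A → a' ∈ A → ∀ b b' : Euc nB, b ∈ B → b' ∈ B →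
      ‖f x a b - f x' a' b'‖ ≤ L1 * ‖x - x'‖ + L2 * ‖a - a'‖ + L3 * ‖b - b'‖)
    (T : ℝ) (hT : 0 < T) (N : ℕ) (hN : 0 < N)
    (L : ℝ) (hL : 0 ≤ L)
    (α abar : Fin N → Euc d × B → A)
    (hαm : ∀ k, Measurable (α k)) (habarm : ∀ k, Measurable (abar k))
    (hαL : ∀ k, LipschitzWith (Real.toNNReal L) (α k))
    (habarL : ∀ k, LipschitzWith (Real.toNNReal L) (abar k))
    (b : Fin N → B) (x y : Euc d) (ΩN : Set (Euc d))
    (hstay : ∀ k ≤ N,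
      fbTraj (fun z a c => z + (T / N) • f z a c) x (extp hN α) (fun j _ => extp hN b j) k ∈ ΩN) :
    ∀ k ≤ N,
      ‖fbTraj (fun z a c => z + (T / N) • f z a c) y (extp hN abar) (fun j _ => extp hN b j) k -
          fbTraj (fun z a c => z + (T / N) • f z a c) x (extp hN α) (fun j _ => extp hN b j) k‖ ≤
        Real.exp ((L1 + L2 * L) * T) *
          (‖y - x‖ + L2 * T *
            ⨆ (j : Fin N) (z : ΩN) (c : B),
              ‖(abar j ((z : Euc d), c) : Euc nA) - (α j ((z : Euc d), c) : Euc nA)‖) := by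
  set F : Euc d → Euc nA → Euc nB → Euc d := fun z a c => z + (T / N) • f z a c
  set Y := fbTraj F y (extp hN abar) (fun j _ => extp hN b j)
  set X := fbTraj F x (extp hN α) (fun j _ => extp hN b j)
  set S := ⨆ (j : Fin N) (z : ΩN) (c : B),
    ‖(abar j ((z : Euc d), c) : Euc nA) - (α j ((z : Euc d), c) : Euc nA)‖
  have hS0 : 0 ≤ S := Real.iSup_nonneg fun _ => Real.iSup_nonneg fun _ =>
    Real.iSup_nonneg fun _ => norm_nonneg _
  have hN' : (0 : ℝ) < N := Nat.cast_pos.2 hN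
  have hτ : 0 ≤ T / N := by positivity
  have hC : 0 ≤ L1 + L2 * L := by positivity
  have hctrl : ∀ (j : Fin N) (z w : Euc d) (c : B), w ∈ ΩN →
      ‖(abar j (z, c) : Euc nA) - (α j (w, c) : Euc nA)‖ ≤ L * ‖z - w‖ + S := by
    intro j z w c hw
    have h1 : ‖(abar j (z, c) : Euc nA) - (abar j (w, c) : Euc nA)‖ ≤ L * ‖z - w‖ := by
      have h := (habarL j).dist_le_mul (z, c) (w, c)
      rw [Real.coe_toNNReal L hL, Prod.dist_eq, dist_self, max_eq_left dist_nonneg,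
        Subtype.dist_eq, dist_eq_norm, dist_eq_norm] at h
      exact h
    have h2 : ‖(abar j (w, c) : Euc nA) - (α j (w, c) : Euc nA)‖ ≤ S :=
      norm_sub_le_iSup₃ hAc.isBounded (fun j (z : ΩN) c => abar j ((z : Euc d), c))
        (fun j (z : ΩN) c => α j ((z : Euc d), c)) j ⟨w, hw⟩ c
    exact (norm_sub_le_norm_sub_add_norm_sub _ _ _).trans (add_le_add h1 h2)
  have hstep : ∀ k < N, ‖Y (k + 1) - X (k + 1)‖ ≤
      (1 + T / N * (L1 + L2 * L)) * ‖Y k - X k‖ + T / N * (L2 * S) := by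
    intro k hk
    let c : B := extp hN b k
    have ha := hctrl ⟨k % N, Nat.mod_lt k hN⟩ (Y k) (X k) c (hstay k hk.le)
    set a' := abar ⟨k % N, Nat.mod_lt k hN⟩ (Y k, c)
    set a := α ⟨k % N, Nat.mod_lt k hN⟩ (X k, c)
    have hfk := hf (Y k) (X k) a' a a'.2 a.2 c c
      c.2 c.2
    rw [sub_self, norm_zero, mul_zero, add_zero] at hfk
    have e : Y (k + 1) - X (k + 1) = (Y k - X k) +
        (T / N) • (f (Y k) a' c - f (X k) a c) := by
      change (Y k + (T / N) • f (Y k) a' c) -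
        (X k + (T / N) • f (X k) a c) = _
      rw [smul_sub]
      abel
    calc ‖Y (k + 1) - X (k + 1)‖
        ≤ ‖Y k - X k‖ + T / N * ‖f (Y k) a' c - f (X k) a c‖ := by
          rw [e]
          refine (norm_add_le _ _).trans_eq ?_
          rw [norm_smul, Real.norm_of_nonneg hτ]
      _ ≤ ‖Y k - X k‖ + T / N * (L1 * ‖Y k - X k‖ + L2 * (L * ‖Y k - X k‖ + S)) := by
          gcongr
          exact hfk.trans (by gcongr)
      _ = _ := by ring
  intro k hk
  have hq : 1 ≤ 1 + T / N * (L1 + L2 * L) := le_add_of_nonneg_right (mul_nonneg hτ hC)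
  have hδ : 0 ≤ T / N * (L2 * S) := by positivity
  have hkN : (k : ℝ) ≤ N := Nat.cast_le.2 hk
  calc ‖Y k - X k‖
      ≤ (1 + T / N * (L1 + L2 * L)) ^ k * (‖Y 0 - X 0‖ + k * (T / N * (L2 * S))) :=
        le_pow_mul_add_of_le_mul_add (e := fun k => ‖Y k - X k‖) hq hδ hstep k hk
    _ ≤ Real.exp ((L1 + L2 * L) * T) * (‖y - x‖ + N * (T / N * (L2 * S))) := by
        refine mul_le_mul ?_ ?_ (by positivity) (Real.exp_nonneg _)
        · calc (1 + T / N * (L1 + L2 * L)) ^ k ≤ (1 + T / N * (L1 + L2 * L)) ^ N :=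
                pow_le_pow_right₀ hq hk
            _ ≤ Real.exp (T / N * (L1 + L2 * L)) ^ N := by
                gcongr
                rw [add_comm]
                exact Real.add_one_le_exp _
            _ = Real.exp ((L1 + L2 * L) * T) := by
                rw [← Real.exp_nat_mul]
                congr 1
                field_simp
        · exact add_le_add le_rfl (mul_le_mul_of_nonneg_right hkN hδ)
    _ = _ := by
        congr 2
        field_simp

end
end

section
/- Suppose the approximate strategy α̂ ∈ (Ĝ_L)^N and the approximate control b̂ ∈ (ℬ̂_M)^N produced by the global scheme satisfy the η_1-suboptimality condition sup_{b ∈ ℬ̂^N} E[ J̃_0(X, α̂[b], b) ] ≤ inf_{α ∈ Ĝ^N} sup_{b ∈ ℬ̂^N} E[ J̃_0(X, α[b], b) ] + η_1, and let α* ∈ (G_L)^N be an ε_1-optimal Lipschitz strategy, i.e., E[V_0(X)] ≥ sup_{b ∈ ℬ^N} E[ J̃_0(X, α*[b], b) ] − ε_1. Define V̂_0(x) = J̃_0(x, α̂[b̂], b̂). Then there exists a constant C_L ≥ 0, depending only on L and on the data, such that E[ V̂_0(X) ] − E[ V_0(X) ] ≤ C_L max_{0≤k≤N−1} d_{L^∞(Ω_N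 × B)}(α*_k, Ĝ_L) + η_1 + ε_1, where d_{L^∞(Ω_N × B)}(α*, Ĝ_L) = inf_{α ∈ Ĝ_L} ‖α − α*‖_{L^∞(Ω_N × B)} and Ω_N = { X_{k,x}^{a,b} : x ∈ Ω_0, 0 ≤ k ≤ N, (a,b) ∈ A^N × B^N } is the discrete reachable set from the support Ω_0 of X. -/
open MeasureTheory Set

noncomputable section

/-- Euler scheme map -/
def euler {d nA nB : ℕ} (f : Euc d → Euc nA → Euc nB → Euc d) (τ : ℝ) :
    Euc d → Euc nA → Euc nB → Euc d :=
  fun z a b => z + τ • f z a b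

/-- discrete reachable set `Ω_N` from `Ω₀` -/
def reachSet {d nA nB : ℕ} (A : Set (Euc nA)) (B : Set (Euc nB))
    (f : Euc d → Euc nA → Euc nB → Euc d) (τ : ℝ) (N : ℕ) (Ω₀ : Set (Euc d)) :
    Set (Euc d) :=
  {z | ∃ x ∈ Ω₀, ∃ k ≤ N, ∃ a : ℕ → A, ∃ b : ℕ → B,
    z = oTraj (euler f τ) x (fun j => (a j : Euc nA)) (fun j => (b j : Euc nB)) k}

lemma extp_apply_of_lt {γ : Sort*} {N : ℕ} (hN : 0 < N) (c : Fin N → γ) {k : ℕ} (hk : k < N) :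
    extp hN c k = c ⟨k, hk⟩ := by
  simp only [extp, Nat.mod_eq_of_lt hk]

/-- Recursive form of `payoff`, with the expected value `φ (xs 0)` at horizon `0`. -/
def recPayoff {d : ℕ} (g φ : Euc d → ℝ) : ℕ → (ℕ → Euc d) → ℝ
  | 0, xs => φ (xs 0)
  | n + 1, xs => g (xs 0) ⊔ recPayoff g φ n (fun k => xs (k + 1))

lemma recPayoff_le_iff {d : ℕ} (g φ : Euc d → ℝ) (n : ℕ) (xs : ℕ → Euc d) (r : ℝ) :
    recPayoff g φ n xs ≤ r ↔ (∀ k < n, g (xs k) ≤ r) ∧ φ (xs n) ≤ r := by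
  induction n generalizing xs with
  | zero => simp [recPayoff]
  | succ n ih =>
    rw [recPayoff, sup_le_iff, ih, Nat.forall_lt_succ_left, and_assoc]

lemma payoff_eq_recPayoff {d : ℕ} (g φ : Euc d → ℝ) {N : ℕ} (hN : 0 < N) (xs : ℕ → Euc d) :
    payoff g φ N xs = recPayoff g φ N xs := by
  have : Nonempty (Fin N) := ⟨⟨0, hN⟩⟩
  refine eq_of_forall_ge_iff fun r => ?_
  rw [recPayoff_le_iff, payoff, sup_le_iff, ciSup_le_iff (Set.finite_range _).bddAbove,
    Fin.forall_iff]

lemma recPayoff_congr {d : ℕ} (g φ : Euc d → ℝ) (n : ℕ) {xs ys : ℕ → Euc d}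
    (h : ∀ k ≤ n, xs k = ys k) : recPayoff g φ n xs = recPayoff g φ n ys := by
  refine eq_of_forall_ge_iff fun r => ?_
  simp only [recPayoff_le_iff, h n le_rfl]
  exact and_congr_left fun _ => forall₂_congr fun k hk => by rw [h k hk.le]

lemma recPayoff_le_add {d : ℕ} {g φ : Euc d → ℝ} {Kg Kφ : NNReal} (hg : LipschitzWith Kg g)
    (hφ : LipschitzWith Kφ φ) (n : ℕ) {xs ys : ℕ → Euc d} {r : ℝ}
    (h : ∀ k ≤ n, ‖xs k - ys k‖ ≤ r) :
    recPayoff g φ n xs ≤ recPayoff g φ n ys + max (Kg : ℝ) Kφ * r := by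
  have hr : 0 ≤ r := (norm_nonneg _).trans (h 0 (Nat.zero_le n))
  have key : ∀ (u : Euc d → ℝ) (K : NNReal), LipschitzWith K u → (K : ℝ) ≤ max (Kg : ℝ) Kφ →
      ∀ k ≤ n, u (xs k) ≤ u (ys k) + max (Kg : ℝ) Kφ * r := fun u K hu hK k hk => by
    refine (hu.le_add_mul (xs k) (ys k)).trans ?_
    rw [dist_eq_norm]
    have := mul_le_mul hK (h k hk) (norm_nonneg _) (K.2.trans hK)
    linarith
  obtain ⟨hgs, hφs⟩ := (recPayoff_le_iff g φ n ys _).1 le_rfl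
  refine (recPayoff_le_iff g φ n xs _).2 ⟨fun k hk => ?_, ?_⟩
  · linarith [key g Kg hg (le_max_left _ _) k hk.le, hgs k hk]
  · linarith [key φ Kφ hφ (le_max_right _ _) n le_rfl]

lemma continuous_recPayoff {d : ℕ} {g φ : Euc d → ℝ} (hg : Continuous g) (hφ : Continuous φ)
    {Z : Type*} [TopologicalSpace Z] (n : ℕ) {xs : Z → ℕ → Euc d}
    (h : ∀ k, Continuous fun z => xs z k) : Continuous fun z => recPayoff g φ n (xs z) := by
  induction n generalizing xs with
  | zero => exact hφ.comp (h 0)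
  | succ n ih => exact (hg.comp (h 0)).sup (ih fun k => h (k + 1))

lemma measurable_recPayoff {d : ℕ} {g φ : Euc d → ℝ} (hg : Measurable g) (hφ : Measurable φ)
    {Z : Type*} [MeasurableSpace Z] (n : ℕ) {xs : Z → ℕ → Euc d}
    (h : ∀ k, Measurable fun z => xs z k) : Measurable fun z => recPayoff g φ n (xs z) := by
  induction n generalizing xs with
  | zero => exact hφ.comp (h 0)
  | succ n ih => exact (hg.comp (h 0)).sup (ih fun k => h (k + 1))

section Trajectories

variable {d nA nB : ℕ} {A : Set (Euc nA)} {B : Set (Euc nB)}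
  {F : Euc d → Euc nA → Euc nB → Euc d}

lemma fbTraj_succ' (x : Euc d) (α : ℕ → Euc d × B → A) (b : ℕ → Euc d → B) (k : ℕ) :
    fbTraj F x α b (k + 1) =
      fbTraj F (F x (α 0 (x, b 0 x) : Euc nA) (b 0 x : Euc nB))
        (fun j => α (j + 1)) (fun j => b (j + 1)) k := by
  induction k with
  | zero => rfl
  | succ k ih => rw [fbTraj, ih]; rfl

lemma fbTraj_eq_openLoop (x : Euc d) (α : ℕ → Euc d × B → A) (b : ℕ → Euc d → B) (k : ℕ) :
    fbTraj F x α b k = fbTraj F x α (fun j _ => b j (fbTraj F x α b j)) k := by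
  induction k with
  | zero => rfl
  | succ k ih => simp only [fbTraj, ← ih]

lemma fbTraj_eq_oTraj (x : Euc d) (α : ℕ → Euc d × B → A) (b : ℕ → Euc d → B) (k : ℕ) :
    fbTraj F x α b k =
      oTraj F x (fun j => (α j (fbTraj F x α b j, b j (fbTraj F x α b j)) : Euc nA))
        (fun j => (b j (fbTraj F x α b j) : Euc nB)) k := by
  induction k with
  | zero => rfl
  | succ k ih => simp only [fbTraj, oTraj, ← ih]

lemma fbTraj_congr (x : Euc d) {α α' : ℕ → Euc d × B → A} {b b' : ℕ → Euc d → B} {n : ℕ}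
    (hα : ∀ k < n, α k = α' k) (hb : ∀ k < n, b k = b' k) :
    ∀ k ≤ n, fbTraj F x α b k = fbTraj F x α' b' k := by
  intro k hk
  induction k with
  | zero => rfl
  | succ k ih => simp only [fbTraj, ih (by omega), hα k hk, hb k hk]

lemma continuous_fbTraj_openLoop
    (hF : Continuous fun p : Euc d × A × B => F p.1 (p.2.1 : Euc nA) (p.2.2 : Euc nB))
    {α : ℕ → Euc d × B → A} (hα : ∀ k, Continuous (α k)) (k : ℕ) :
    Continuous fun p : Euc d × (ℕ → B) => fbTraj F p.1 α (fun j _ => p.2 j) k := by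
  induction k with
  | zero => exact continuous_fst
  | succ k ih =>
    have hb : Continuous fun p : Euc d × (ℕ → B) => p.2 k := by fun_prop
    exact hF.comp (ih.prodMk (((hα k).comp (ih.prodMk hb)).prodMk hb))

lemma continuous_oTraj
    (hF : Continuous fun p : Euc d × A × B => F p.1 (p.2.1 : Euc nA) (p.2.2 : Euc nB)) (k : ℕ) :
    Continuous fun p : Euc d × (ℕ → A) × (ℕ → B) =>
      oTraj F p.1 (fun j => (p.2.1 j : Euc nA)) (fun j => (p.2.2 j : Euc nB)) k := by
  induction k with
  | zero => exact continuous_fst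
  | succ k ih =>
    have ha : Continuous fun p : Euc d × (ℕ → A) × (ℕ → B) => p.2.1 k := by fun_prop
    have hb : Continuous fun p : Euc d × (ℕ → A) × (ℕ → B) => p.2.2 k := by fun_prop
    exact hF.comp (ih.prodMk (ha.prodMk hb))

lemma measurable_fbTraj
    (hF : Continuous fun p : Euc d × A × B => F p.1 (p.2.1 : Euc nA) (p.2.2 : Euc nB))
    {α : ℕ → Euc d × B → A} (hα : ∀ k, Measurable (α k)) {b : ℕ → Euc d → B}
    (hb : ∀ k, Measurable (b k)) (k : ℕ) : Measurable fun x => fbTraj F x α b k := by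
  induction k with
  | zero => exact measurable_id
  | succ k ih =>
    have hbk := (hb k).comp ih
    exact hF.measurable.comp (ih.prodMk (((hα k).comp (ih.prodMk hbk)).prodMk hbk))

/-- Payoffs of trajectories issued from a compact set are uniformly bounded. -/
lemma exists_abs_recPayoff_le [CompactSpace A] [CompactSpace B]
    (hF : Continuous fun p : Euc d × A × B => F p.1 (p.2.1 : Euc nA) (p.2.2 : Euc nB))
    {g φ : Euc d → ℝ} (hg : Continuous g) (hφ : Continuous φ) {Ω : Set (Euc d)}
    (hΩ : IsCompact Ω) (n : ℕ) :
    ∃ R : ℝ, ∀ x ∈ Ω, ∀ (α : ℕ → Euc d × B → A) (b : ℕ → Euc d → B),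
      ‖recPayoff g φ n (fbTraj F x α b)‖ ≤ R := by
  have hK : IsCompact (Ω ×ˢ (univ : Set ((ℕ → A) × (ℕ → B)))) := hΩ.prod isCompact_univ
  have hc := continuous_recPayoff hg hφ n (continuous_oTraj hF)
  obtain ⟨R, hR⟩ := hK.exists_bound_of_continuousOn hc.continuousOn
  refine ⟨R, fun x hx α b => ?_⟩
  rw [recPayoff_congr g φ n fun k _ => fbTraj_eq_oTraj x α b k]
  exact hR (x, fun j => α j (fbTraj F x α b j, b j (fbTraj F x α b j)),
    fun j => b j (fbTraj F x α b j)) ⟨hx, mem_univ _⟩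

/-- Discrete Gronwall estimate for two feedback strategies played against the same open-loop
control. -/
lemma norm_fbTraj_sub_le {K1 K2 K3 : ℝ} (hK1 : 0 ≤ K1) (hK2 : 0 ≤ K2)
    (hF : ∀ (x x' : Euc d) (a a' : A) (b b' : B),
      ‖F x a b - F x' a' b'‖ ≤ K1 * ‖x - x'‖ + K2 * ‖(a : Euc nA) - a'‖ + K3 * ‖(b : Euc nB) - b'‖)
    {K : NNReal} {α β : ℕ → Euc d × B → A} (hα : ∀ k, LipschitzWith K (α k)) (x : Euc d)
    (c : ℕ → B) {n : ℕ} {e : ℝ} (he : 0 ≤ e)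
    (hclose : ∀ k < n, ‖(α k (fbTraj F x β (fun j _ => c j) k, c k) : Euc nA) -
      β k (fbTraj F x β (fun j _ => c j) k, c k)‖ ≤ e) :
    ∀ k ≤ n, ‖fbTraj F x α (fun j _ => c j) k - fbTraj F x β (fun j _ => c j) k‖ ≤
      K2 * (∑ i ∈ Finset.range n, (K1 + K2 * K) ^ i) * e := by
  have hq : 0 ≤ K1 + K2 * K := by positivity
  suffices h : ∀ k ≤ n, ‖fbTraj F x α (fun j _ => c j) k - fbTraj F x β (fun j _ => c j) k‖ ≤
      K2 * (∑ i ∈ Finset.range k, (K1 + K2 * K) ^ i) * e by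
    intro k hk
    refine (h k hk).trans ?_
    gcongr
  intro k hk
  induction k with
  | zero => simp [fbTraj]
  | succ k ih =>
    set y := fbTraj F x α (fun j _ => c j) k with hy
    set z := fbTraj F x β (fun j _ => c j) k with hz
    have hyz := ih (by omega)
    have h1 : ‖(α k (y, c k) : Euc nA) - β k (z, c k)‖ ≤ K * ‖y - z‖ + e := by
      refine (norm_sub_le_norm_sub_add_norm_sub _ (α k (z, c k) : Euc nA) _).trans
        (add_le_add ?_ (hclose k hk))
      have := (hα k).dist_le_mul (y, c k) (z, c k)
      rwa [Prod.dist_eq, dist_self, max_eq_left dist_nonneg, Subtype.dist_eq, dist_eq_norm,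
        dist_eq_norm] at this
    have h2 := hF y z (α k (y, c k)) (β k (z, c k)) (c k) (c k)
    rw [sub_self, norm_zero, mul_zero, add_zero] at h2
    rw [fbTraj, fbTraj, ← hy, ← hz, geom_sum_succ]
    have h3 := mul_le_mul_of_nonneg_left h1 hK2
    have h4 := mul_le_mul_of_nonneg_left hyz hq
    linarith

end Trajectories

/-- Measurable selection of approximate maximizers of a lower semicontinuous family. -/
lemma exists_measurable_approx_argmax {S Y : Type*} [MeasurableSpace S] [TopologicalSpace Y]
    [TopologicalSpace.SeparableSpace Y] [Nonempty Y] [MeasurableSpace Y] {H : S → Y → ℝ}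
    (hmeas : ∀ c, Measurable fun x => H x c) (hlsc : ∀ x, LowerSemicontinuous (H x))
    (hbdd : ∀ x, BddAbove (range (H x))) {δ : ℝ} (hδ : 0 < δ) :
    ∃ b : S → Y, Measurable b ∧ ∀ x c, H x c ≤ H x (b x) + δ := by
  classical
  let s := TopologicalSpace.denseSeq Y
  have hbdd' : ∀ x, BddAbove (range fun n => H x (s n)) := fun x =>
    (hbdd x).mono (range_comp_subset_range s (H x))
  let σ : S → ℝ := fun x => ⨆ n, H x (s n)
  have hσ : Measurable σ := Measurable.iSup fun n => hmeas (s n)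
  have hex : ∀ x, ∃ n, σ x < H x (s n) + δ := fun x => by
    obtain ⟨n, hn⟩ := exists_lt_of_lt_ciSup (sub_lt_self (σ x) hδ)
    exact ⟨n, by linarith⟩
  refine ⟨fun x => s (Nat.find (hex x)), ?_, fun x c => ?_⟩
  · exact Measurable.find (f := fun n _ => s n) (fun n => measurable_const)
      (fun n => measurableSet_lt hσ ((hmeas (s n)).add_const δ)) hex
  · refine le_trans ?_ (Nat.find_spec (hex x)).le
    refine le_of_forall_lt fun r hr => ?_
    obtain ⟨n, hn⟩ := (TopologicalSpace.denseRange_denseSeq Y).exists_mem_open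
      ((hlsc x).isOpen_preimage r) ⟨c, hr⟩
    exact lt_of_lt_of_le hn (le_ciSup (hbdd' x) n)

/-- Against a continuous feedback strategy, some measurable feedback control is, uniformly in the
initial state, almost as good as every open-loop control. -/
lemma exists_feedback_approx_optimal {d nA nB : ℕ} {A : Set (Euc nA)} {B : Set (Euc nB)}
    [CompactSpace B] [Nonempty B] {F : Euc d → Euc nA → Euc nB → Euc d}
    (hF : Continuous fun p : Euc d × A × B => F p.1 (p.2.1 : Euc nA) (p.2.2 : Euc nB))
    {g φ : Euc d → ℝ} (hg : Continuous g) (hφ : Continuous φ) (n : ℕ)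
    {α : ℕ → Euc d × B → A} (hα : ∀ k, Continuous (α k)) {δ : ℝ} (hδ : 0 < δ) :
    ∃ b : ℕ → Euc d → B, (∀ k, Measurable (b k)) ∧ ∀ (x : Euc d) (c : ℕ → B),
      recPayoff g φ n (fbTraj F x α fun j _ => c j) ≤ recPayoff g φ n (fbTraj F x α b) + δ := by
  induction n generalizing α δ with
  | zero =>
    exact ⟨fun _ _ => Classical.arbitrary B, fun _ => measurable_const, fun x c => by
      simp only [recPayoff, fbTraj]; linarith⟩
  | succ n ih =>
    obtain ⟨b', hb', hopt'⟩ := ih (α := fun j => α (j + 1)) (fun k => hα (k + 1)) (half_pos hδ)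
    let P : Euc d → (ℕ → B) → ℝ := fun y c =>
      recPayoff g φ n (fbTraj F y (fun j => α (j + 1)) fun j _ => c j)
    have hP : Continuous fun p : Euc d × (ℕ → B) => P p.1 p.2 :=
      continuous_recPayoff hg hφ n (continuous_fbTraj_openLoop hF fun k => hα (k + 1))
    have hPb : ∀ y, BddAbove (range (P y)) := fun y =>
      (isCompact_range (hP.comp (Continuous.prodMk_right y))).bddAbove
    let V : Euc d → ℝ := fun y => ⨆ c, P y c
    have hV : LowerSemicontinuous V := lowerSemicontinuous_ciSup hPb fun c =>
      (hP.comp (Continuous.prodMk_left c)).lowerSemicontinuous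
    have hVle : ∀ y, V y ≤ recPayoff g φ n (fbTraj F y (fun j => α (j + 1)) b') + δ / 2 := fun y =>
      ciSup_le fun c => hopt' y c
    let Φ : Euc d × B → Euc d := fun p => F p.1 (α 0 p : Euc nA) (p.2 : Euc nB)
    have hΦ : Continuous Φ := hF.comp (continuous_fst.prodMk ((hα 0).prodMk continuous_snd))
    obtain ⟨b0, hb0, hopt0⟩ := exists_measurable_approx_argmax
      (H := fun x c => V (Φ (x, c)))
      (fun c => hV.measurable.comp (hΦ.comp (Continuous.prodMk_left c)).measurable)
      (fun x => hV.comp (hΦ.comp (Continuous.prodMk_right x)))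
      (fun x => by
        have hc : Continuous fun q : B × (ℕ → B) => P (Φ (x, q.1)) q.2 :=
          hP.comp ((hΦ.comp (by fun_prop : Continuous fun q : B × (ℕ → B) => (x, q.1))).prodMk
            continuous_snd)
        obtain ⟨R, hR⟩ := (isCompact_range hc).bddAbove
        refine ⟨R, ?_⟩
        rintro _ ⟨c, rfl⟩
        exact ciSup_le fun c' => hR ⟨(c, c'), rfl⟩)
      (half_pos hδ)
    refine ⟨fun k => Nat.casesOn k b0 b', fun k => by cases k; exacts [hb0, hb' _], fun x c => ?_⟩
    simp only [recPayoff, fbTraj_succ']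
    refine sup_le ?_ ?_
    · exact le_add_of_le_of_nonneg le_sup_left hδ.le
    · have h1 := le_ciSup (hPb (Φ (x, c 0))) (fun j => c (j + 1))
      have h2 := hopt0 x (c 0)
      have h3 := hVle (Φ (x, b0 x))
      refine le_trans ?_ (add_le_add_left le_sup_right δ)
      have h4 : V (Φ (x, b0 x)) + δ / 2 ≤
          recPayoff g φ n (fbTraj F (Φ (x, b0 x)) (fun j => α (j + 1)) b') + δ := by linarith
      exact h1.trans (h2.trans h4)

lemma norm_euler_sub_le {d nA nB : ℕ} {A : Set (Euc nA)} {B : Set (Euc nB)}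
    {f : Euc d → Euc nA → Euc nB → Euc d} {L1 L2 L3 : ℝ}
    (hf : ∀ x x' : Euc d, ∀ a a' : Euc nA, a ∈ A → a' ∈ A → ∀ b b' : Euc nB, b ∈ B → b' ∈ B →
      ‖f x a b - f x' a' b'‖ ≤ L1 * ‖x - x'‖ + L2 * ‖a - a'‖ + L3 * ‖b - b'‖)
    {τ : ℝ} (hτ : 0 ≤ τ) (x x' : Euc d) (a a' : A) (b b' : B) :
    ‖euler f τ x a b - euler f τ x' a' b'‖ ≤ (1 + τ * L1) * ‖x - x'‖ +
      τ * L2 * ‖(a : Euc nA) - a'‖ + τ * L3 * ‖(b : Euc nB) - b'‖ := by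
  have h1 : euler f τ x a b - euler f τ x' a' b' = (x - x') + τ • (f x a b - f x' a' b') := by
    simp only [euler, smul_sub]; abel
  rw [h1]
  refine (norm_add_le _ _).trans ?_
  rw [norm_smul, Real.norm_of_nonneg hτ]
  have := mul_le_mul_of_nonneg_left (hf x x' a a' a.2 a'.2 b b' b.2 b'.2) hτ
  linarith

lemma continuous_of_norm_sub_le {d nA nB : ℕ} {A : Set (Euc nA)} {B : Set (Euc nB)}
    {F : Euc d → Euc nA → Euc nB → Euc d} {K1 K2 K3 : ℝ}
    (hF : ∀ (x x' : Euc d) (a a' : A) (b b' : B),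
      ‖F x a b - F x' a' b'‖ ≤
        K1 * ‖x - x'‖ + K2 * ‖(a : Euc nA) - a'‖ + K3 * ‖(b : Euc nB) - b'‖) :
    Continuous fun p : Euc d × A × B => F p.1 (p.2.1 : Euc nA) (p.2.2 : Euc nB) := by
  refine continuous_iff_continuousAt.2 fun p => ?_
  refine tendsto_iff_norm_sub_tendsto_zero.2 ?_
  refine squeeze_zero (fun q => norm_nonneg _) (fun q => hF q.1 p.1 q.2.1 p.2.1 q.2.2 p.2.2) ?_
  have hc : Continuous fun q : Euc d × A × B => K1 * ‖q.1 - p.1‖ +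
      K2 * ‖(q.2.1 : Euc nA) - p.2.1‖ + K3 * ‖(q.2.2 : Euc nB) - p.2.2‖ := by fun_prop
  simpa using hc.tendsto p

/-- Changing a Lipschitz strategy by at most `e` on the reachable set raises the expected payoff
against any feedback control by at most a multiple of `e`, up to optimizing the control. -/
lemma integral_tJ0fb_le_iSup_add {d nA nB : ℕ} {A : Set (Euc nA)} {B : Set (Euc nB)}
    [CompactSpace A] [CompactSpace B] [Nonempty B]
    {f : Euc d → Euc nA → Euc nB → Euc d} {L1 L2 L3 : ℝ} (hL1 : 0 ≤ L1) (hL2 : 0 ≤ L2)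
    (hf : ∀ x x' : Euc d, ∀ a a' : Euc nA, a ∈ A → a' ∈ A → ∀ b b' : Euc nB, b ∈ B → b' ∈ B →
      ‖f x a b - f x' a' b'‖ ≤ L1 * ‖x - x'‖ + L2 * ‖a - a'‖ + L3 * ‖b - b'‖)
    {g φ : Euc d → ℝ} {Kg Kφ : NNReal} (hg : LipschitzWith Kg g) (hφ : LipschitzWith Kφ φ)
    {τ : ℝ} (hτ : 0 ≤ τ) {N : ℕ} (hN : 0 < N)
    {W : Type*} [MeasurableSpace W] {μ : Measure W} [IsProbabilityMeasure μ]
    {X : W → Euc d} (hX : Measurable X) {Ω₀ : Set (Euc d)} (hΩ₀c : IsCompact Ω₀)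
    (hXsupp : ∀ᵐ ω ∂μ, X ω ∈ Ω₀) {K : NNReal} {α β : Fin N → Euc d × B → A}
    (hα : ∀ k, LipschitzWith K (α k)) (hβ : ∀ k, Measurable (β k)) {e : ℝ} (he : 0 ≤ e)
    (hclose : ∀ k, ∀ z ∈ reachSet A B f τ N Ω₀, ∀ c : B,
      ‖(α k (z, c) : Euc nA) - β k (z, c)‖ ≤ e)
    {b : Fin N → Euc d → B} (hb : ∀ k, Measurable (b k)) :
    ∫ ω, tJ0fb (euler f τ) g φ hN (X ω) β b ∂μ ≤
      (⨆ b : Fin N → Bm d B,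
        ∫ ω, tJ0fb (euler f τ) g φ hN (X ω) α (fun k => (b k).1) ∂μ) +
      max (Kg : ℝ) Kφ * (τ * L2 * (∑ i ∈ Finset.range N, (1 + τ * L1 + τ * L2 * K) ^ i)) * e := by
  have hFL := norm_euler_sub_le hf hτ
  have hFc := continuous_of_norm_sub_le hFL
  obtain ⟨R, hR⟩ := exists_abs_recPayoff_le (F := euler f τ) hFc hg.continuous hφ.continuous hΩ₀c N
  have hbound : ∀ (γ : Fin N → Euc d × B → A) (b : Fin N → Euc d → B),
      ∀ᵐ ω ∂μ, ‖tJ0fb (euler f τ) g φ hN (X ω) γ b‖ ≤ R := fun γ b => by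
    filter_upwards [hXsupp] with ω hω
    rw [tJ0fb, payoff_eq_recPayoff g φ hN]
    exact hR _ hω _ _
  have hint : ∀ (γ : Fin N → Euc d × B → A) (b : Fin N → Euc d → B), (∀ k, Measurable (γ k)) →
      (∀ k, Measurable (b k)) →
      Integrable (fun ω => tJ0fb (euler f τ) g φ hN (X ω) γ b) μ := fun γ b hγ hb => by
    refine Integrable.of_bound (Measurable.aestronglyMeasurable ?_) R (hbound γ b)
    simp only [tJ0fb, payoff_eq_recPayoff g φ hN]
    exact measurable_recPayoff hg.continuous.measurable hφ.continuous.measurable N fun k =>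
      (measurable_fbTraj hFc (fun k => hγ _) (fun k => hb _) k).comp hX
  refine le_of_forall_pos_le_add fun δ hδ => ?_
  obtain ⟨b', hb', hopt⟩ := exists_feedback_approx_optimal (F := euler f τ) hFc hg.continuous
    hφ.continuous N (α := extp hN α) (fun k => (hα _).continuous) hδ
  have hpt : ∀ᵐ ω ∂μ, tJ0fb (euler f τ) g φ hN (X ω) β b ≤
      tJ0fb (euler f τ) g φ hN (X ω) α (fun k => b' k) + (max (Kg : ℝ) Kφ *
        (τ * L2 * (∑ i ∈ Finset.range N, (1 + τ * L1 + τ * L2 * K) ^ i)) * e + δ) := by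
    filter_upwards [hXsupp] with ω hω
    rw [tJ0fb, tJ0fb, payoff_eq_recPayoff g φ hN, payoff_eq_recPayoff g φ hN,
      recPayoff_congr g φ N fun k _ => fbTraj_eq_openLoop (X ω) (extp hN β) (extp hN b) k,
      recPayoff_congr g φ N (fbTraj_congr (X ω) (α := extp hN α) (fun k _ => rfl)
        (b := extp hN fun k : Fin N => b' k) (b' := b') fun k hk => extp_apply_of_lt hN _ hk)]
    set c : ℕ → B := fun j => extp hN b j (fbTraj (euler f τ) (X ω) (extp hN β) (extp hN b) j)
    have hdist := norm_fbTraj_sub_le (F := euler f τ) (K1 := 1 + τ * L1) (K2 := τ * L2)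
      (by positivity) (by positivity) hFL (α := extp hN α) (β := extp hN β) (fun k => hα _)
      (X ω) c (n := N) he (fun k hk => by
        rw [extp_apply_of_lt hN α hk, extp_apply_of_lt hN β hk]
        exact hclose _ _ ⟨X ω, hω, k, hk.le, _, _, fbTraj_eq_oTraj _ _ _ k⟩ _)
    have h1 := recPayoff_le_add hg hφ N fun k hk => (norm_sub_rev _ _).trans_le (hdist k hk)
    have h2 := hopt (X ω) c
    linarith
  have hle := integral_mono_ae (hint β b hβ hb)
    ((hint α (fun k => b' k) (fun k => (hα k).continuous.measurable)
      fun k => hb' k).add (integrable_const _)) hpt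
  simp only [Pi.add_apply] at hle
  rw [integral_add (hint α (fun k => b' k) (fun k => (hα k).continuous.measurable)
      fun k => hb' k) (integrable_const _), integral_const, probReal_univ, one_smul] at hle
  have hsup := le_ciSup (f := fun b : Fin N → Bm d B =>
      ∫ ω, tJ0fb (euler f τ) g φ hN (X ω) α (fun k => (b k).1) ∂μ)
    ⟨R, by
      rintro _ ⟨b, rfl⟩
      have := norm_integral_le_of_norm_le_const (hbound α fun k => (b k).1)
      rw [probReal_univ, mul_one] at this
      exact (le_abs_self _).trans this⟩ (fun k => ⟨b' k, hb' k⟩)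
  dsimp only at hsup
  linarith

/-- Approximate minimizers of the uniform distance to `α` on a set of states. -/
lemma exists_norm_sub_le_iInf_add {d nA nB : ℕ} {A : Set (Euc nA)} {B : Set (Euc nB)}
    [CompactSpace A] [Nonempty B] (α : Euc d × B → A) {p : (Euc d × B → A) → Prop}
    (hp : ∃ β, p β) (Ω : Set (Euc d)) {δ : ℝ} (hδ : 0 < δ) :
    ∃ β, p β ∧ ∀ z ∈ Ω, ∀ c : B, ‖(α (z, c) : Euc nA) - β (z, c)‖ ≤
      (⨅ β : {aa : Euc d × B → A // p aa}, ⨆ (z : Ω) (c : B),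
        ‖(α ((z : Euc d), c) : Euc nA) - (β.1 ((z : Euc d), c) : Euc nA)‖) + δ := by
  have : Nonempty {aa : Euc d × B → A // p aa} := nonempty_subtype.2 hp
  obtain ⟨β, hβ⟩ := exists_lt_of_ciInf_lt (lt_add_of_pos_right
    (⨅ β : {aa : Euc d × B → A // p aa}, ⨆ (z : Ω) (c : B),
        ‖(α ((z : Euc d), c) : Euc nA) - (β.1 ((z : Euc d), c) : Euc nA)‖) hδ)
  have hdiam : ∀ a a' : A, ‖(a : Euc nA) - a'‖ ≤ Metric.diam (univ : Set A) := fun a a' => by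
    rw [← dist_eq_norm]
    exact Metric.dist_le_diam_of_mem isCompact_univ.isBounded (mem_univ a) (mem_univ a')
  refine ⟨β.1, β.2, fun z hz c => le_trans ?_ hβ.le⟩
  refine le_trans ?_ (le_ciSup ⟨Metric.diam (univ : Set A), ?_⟩ (⟨z, hz⟩ : Ω))
  · exact le_ciSup (f := fun c : B => ‖(α (z, c) : Euc nA) - β.1 (z, c)‖)
      ⟨_, by rintro _ ⟨c, rfl⟩; exact hdiam _ _⟩ c
  · rintro _ ⟨z, rfl⟩
    exact ciSup_le fun c => hdiam _ _

theorem global_scheme_upper_error_estimate {d nA nB : ℕ} (hnA : 1 ≤ nA) (hnB : 1 ≤ nB)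
    (A : Set (Euc nA)) (hAne : A.Nonempty) (hAc : IsCompact A)
    (B : Set (Euc nB)) (hBne : B.Nonempty) (hBc : IsCompact B)
    (f : Euc d → Euc nA → Euc nB → Euc d)
    (L1 L2 L3 : ℝ) (hL1 : 0 ≤ L1) (hL2 : 0 ≤ L2) (hL3 : 0 ≤ L3)
    (hf : ∀ x x' : Euc d, ∀ a a' : Euc nA, a ∈ A → a' ∈ A → ∀ b b' : Euc nB, b ∈ B → b' ∈ B →
      ‖f x a b - f x' a' b'‖ ≤ L1 * ‖x - x'‖ + L2 * ‖a - a'‖ + L3 * ‖b - b'‖)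
    (g φ : Euc d → ℝ) (Kg Kφ : NNReal) (hg : LipschitzWith Kg g) (hφ : LipschitzWith Kφ φ)
    (T : ℝ) (hT : 0 < T) (N : ℕ) (hN : 0 < N)
    {W : Type*} [MeasurableSpace W] (μ : Measure W) [IsProbabilityMeasure μ]
    (X : W → Euc d) (hX : Measurable X)
    (hXint : Integrable (fun ω => ‖X ω‖) μ)
    (Ω₀ : Set (Euc d)) (hΩ₀c : IsCompact Ω₀) (hXsupp : ∀ᵐ ω ∂μ, X ω ∈ Ω₀)
    -- approximation spaces
    (Ghat : Set (Euc d × B → A)) (hGhat : ∀ α ∈ Ghat, Measurable α)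
    (Bhat : Set (Euc d → B)) (hBhat : ∀ b ∈ Bhat, Measurable b)
    (L M : ℝ) (hL : 0 ≤ L) (hM : 0 ≤ M) :
    -- a constant depending only on `L` and the data
    ∃ C : ℝ, 0 ≤ C ∧
      ∀ (αhat : Fin N → Euc d × B → A) (bhat : Fin N → Euc d → B)
        (αstar : Fin N → Euc d × B → A) (η₁ ε₁ : ℝ), 0 ≤ η₁ → 0 ≤ ε₁ →
        -- `α̂ ∈ (Ĝ_L)^N`, `b̂ ∈ (ℬ̂_M)^N`
        (∀ k, αhat k ∈ Ghat ∧ LipschitzWith (Real.toNNReal L) (αhat k)) →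
        (∀ k, bhat k ∈ Bhat ∧ LipschitzWith (Real.toNNReal M) (bhat k)) →
        -- `η₁`-suboptimality of `α̂` in the approximation class
        ((⨆ b : Fin N → {bb : Euc d → B // bb ∈ Bhat},
            ∫ ω, tJ0fb (euler f (T / N)) g φ hN (X ω) αhat (fun k => (b k).1) ∂μ) ≤
          (⨅ α : Fin N → {aa : Euc d × B → A // aa ∈ Ghat},
            ⨆ b : Fin N → {bb : Euc d → B // bb ∈ Bhat},
              ∫ ω, tJ0fb (euler f (T / N)) g φ hN (X ω)
                (fun k => (α k).1) (fun k => (b k).1) ∂μ) + η₁) →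
        -- `α* ∈ (G_L)^N` is `ε₁`-optimal
        (∀ k, Measurable (αstar k) ∧ LipschitzWith (Real.toNNReal L) (αstar k)) →
        ((∫ ω, V0 A B (euler f (T / N)) g φ hN (X ω) ∂μ) ≥
          (⨆ b : Fin N → Bm d B,
            ∫ ω, tJ0fb (euler f (T / N)) g φ hN (X ω) αstar (fun k => (b k).1) ∂μ) - ε₁) →
        -- conclusion: upper weak error estimate for `V̂₀ = J̃₀(·, α̂[b̂], b̂)`
        (∫ ω, tJ0fb (euler f (T / N)) g φ hN (X ω) αhat bhat ∂μ) -
            (∫ ω, V0 A B (euler f (T / N)) g φ hN (X ω) ∂μ) ≤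
          C * (⨆ k : Fin N,
              ⨅ α : {aa : Euc d × B → A // aa ∈ Ghat ∧ LipschitzWith (Real.toNNReal L) aa},
                ⨆ (z : reachSet A B f (T / N) N Ω₀) (c : B),
                  ‖(αstar k ((z : Euc d), c) : Euc nA) - (α.1 ((z : Euc d), c) : Euc nA)‖) +
            η₁ + ε₁ := by
  have : CompactSpace A := isCompact_iff_compactSpace.1 hAc
  have : CompactSpace B := isCompact_iff_compactSpace.1 hBc
  have : Nonempty B := hBne.to_subtype
  have hτ : 0 ≤ T / N := by positivity
  set τ := T / N
  have hFc := continuous_of_norm_sub_le (norm_euler_sub_le hf hτ)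
  obtain ⟨R, hR⟩ := exists_abs_recPayoff_le (F := euler f τ) hFc hg.continuous hφ.continuous hΩ₀c N
  have hbound : ∀ (γ : Fin N → Euc d × B → A) (b : Fin N → Euc d → B),
      |∫ ω, tJ0fb (euler f τ) g φ hN (X ω) γ b ∂μ| ≤ R := fun γ b => by
    have h : ∀ᵐ ω ∂μ, ‖tJ0fb (euler f τ) g φ hN (X ω) γ b‖ ≤ R := by
      filter_upwards [hXsupp] with ω hω
      rw [tJ0fb, payoff_eq_recPayoff g φ hN]
      exact hR _ hω _ _
    have := norm_integral_le_of_norm_le_const h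
    rwa [probReal_univ, mul_one] at this
  set C : ℝ := max (Kg : ℝ) Kφ *
    (τ * L2 * (∑ i ∈ Finset.range N, (1 + τ * L1 + τ * L2 * (Real.toNNReal L : ℝ)) ^ i))
  have hC0 : 0 ≤ C := by positivity
  refine ⟨C, hC0, fun αhat bhat αstar η₁ ε₁ _ _ hαhat hbhat hsub hαstar hopt => ?_⟩
  have : Nonempty {bb : Euc d → B // bb ∈ Bhat} := ⟨⟨_, (hbhat ⟨0, hN⟩).1⟩⟩
  have hbdd : ∀ γ : Fin N → Euc d × B → A,
      BddAbove (range fun b : Fin N → {bb : Euc d → B // bb ∈ Bhat} =>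
        ∫ ω, tJ0fb (euler f τ) g φ hN (X ω) γ (fun k => (b k).1) ∂μ) := fun γ =>
    ⟨R, by rintro _ ⟨b, rfl⟩; exact (abs_le.1 (hbound _ _)).2⟩
  have hhat := le_ciSup (hbdd αhat) (fun k => ⟨bhat k, (hbhat k).1⟩)
  dsimp only at hhat
  set D : Fin N → ℝ := fun k =>
    ⨅ α : {aa : Euc d × B → A // aa ∈ Ghat ∧ LipschitzWith (Real.toNNReal L) aa},
      ⨆ (z : reachSet A B f τ N Ω₀) (c : B),
        ‖(αstar k ((z : Euc d), c) : Euc nA) - (α.1 ((z : Euc d), c) : Euc nA)‖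
  have hD0 : 0 ≤ ⨆ k, D k := Real.iSup_nonneg fun k => Real.iInf_nonneg fun α =>
    Real.iSup_nonneg fun z => Real.iSup_nonneg fun c => norm_nonneg _
  have key : ∀ δ > 0, (⨅ α : Fin N → {aa : Euc d × B → A // aa ∈ Ghat},
      ⨆ b : Fin N → {bb : Euc d → B // bb ∈ Bhat},
        ∫ ω, tJ0fb (euler f τ) g φ hN (X ω) (fun k => (α k).1) (fun k => (b k).1) ∂μ) ≤
      (⨆ b : Fin N → Bm d B,
        ∫ ω, tJ0fb (euler f τ) g φ hN (X ω) αstar (fun k => (b k).1) ∂μ) +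
      C * ((⨆ k, D k) + δ) := fun δ hδ => by
    choose β hβ hβclose using fun k => exists_norm_sub_le_iInf_add (αstar k)
      (p := fun aa => aa ∈ Ghat ∧ LipschitzWith (Real.toNNReal L) aa) ⟨αhat k, hαhat k⟩
      (reachSet A B f τ N Ω₀) hδ
    refine (ciInf_le ⟨-R, ?_⟩ (fun k => ⟨β k, (hβ k).1⟩)).trans (ciSup_le fun b => ?_)
    · rintro _ ⟨γ, rfl⟩
      exact (abs_le.1 (hbound _ _)).1.trans
        (le_ciSup (hbdd fun k => (γ k).1) (Classical.arbitrary _))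
    · exact integral_tJ0fb_le_iSup_add hL1 hL2 hf hg hφ hτ hN hX hΩ₀c hXsupp
        (fun k => (hαstar k).2) (fun k => hGhat _ (hβ k).1) (by positivity)
        (fun k z hz c => (hβclose k z hz c).trans
          (add_le_add_left (le_ciSup (Set.finite_range D).bddAbove k) δ))
        (fun k => hBhat _ (b k).2)
  have hlim : (⨅ α : Fin N → {aa : Euc d × B → A // aa ∈ Ghat},
      ⨆ b : Fin N → {bb : Euc d → B // bb ∈ Bhat},
        ∫ ω, tJ0fb (euler f τ) g φ hN (X ω) (fun k => (α k).1) (fun k => (b k).1) ∂μ) ≤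
      (⨆ b : Fin N → Bm d B,
        ∫ ω, tJ0fb (euler f τ) g φ hN (X ω) αstar (fun k => (b k).1) ∂μ) +
      C * (⨆ k, D k) := by
    refine le_of_forall_pos_le_add fun δ hδ => (key (δ / (C + 1)) (by positivity)).trans ?_
    have : C * (δ / (C + 1)) ≤ δ := by
      rw [mul_div_assoc', div_le_iff₀ (by positivity)]
      nlinarith
    linarith
  linarith

end
end
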